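/- Uniform within-task drift (Lemma 1): Assume every stochastic gradient is bounded in norm by B (Assumption A1). Then for every task i ∈ {1,…,K} and every round t ∈ {0,…,T}, the global models produced by SPECIAL satisfy E‖θ_i^t − θ_i^0‖² ≤ γ_G²γ_L²E²B²/λ², a bound that is independent of the round index t and the task index i. -/

import Mathlib

open MeasureTheory

/-- Uniform within-task drift (Lemma 1): under the SPECIAL dynamics (local SGD with
rate `γ_L` for `E` epochs, aggregation of a uniformly sampled size-`N` subset of the
`M` clients with global rate `γ_G`, and the server-side proximal anchor with weight
`λ > 0`), if every stochastic gradient is bounded in norm by `B` (Assumption A1), then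
for every task `i ∈ {1,…,K}` and every round `t ∈ {0,…,T}`,
`E‖θ_i^t − θ_i^0‖² ≤ γ_G² γ_L² E² B² / λ²`, independently of `t` and `i`. -/
theorem special_uniform_within_task_drift
    {d M K N E T : ℕ} (hM : 1 ≤ M) (hN1 : 1 ≤ N) (hNM : N ≤ M) (hK : 1 ≤ K) (hE : 1 ≤ E)
    (B lam γL γG : ℝ) (hB : 0 < B) (hlam : 0 < lam) (hγL : 0 < γL) (hγG : 0 < γG)
    {Ω : Type*} [MeasurableSpace Ω] (μ : Measure Ω) [IsProbabilityMeasure μ]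
    -- global models: task index `i`, round index `t`
    (θ : ℕ → ℕ → Ω → EuclideanSpace ℝ (Fin d))
    -- local models and stochastic gradients: task `i`, round `t`, client `m`, epoch `e`
    (θloc : ℕ → ℕ → Fin M → ℕ → Ω → EuclideanSpace ℝ (Fin d))
    (g : ℕ → ℕ → Fin M → ℕ → Ω → EuclideanSpace ℝ (Fin d))
    -- sampled client sets
    (S : ℕ → ℕ → Ω → Finset (Fin M))
    -- each task starts from the final model of the previous task
    (hchain : ∀ i ω, θ (i + 1) 0 ω = θ i T ω)
    -- local SGD dynamics
    (hlocinit : ∀ i t m ω, θloc i t m 0 ω = θ i t ω)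
    (hlocstep : ∀ i t m e ω, e < E →
      θloc i t m (e + 1) ω = θloc i t m e ω - γL • g i t m e ω)
    -- partial participation: `N` clients sampled uniformly without replacement
    (hcard : ∀ i t ω, (S i t ω).card = N)
    (hunif : ∀ i t (A : Finset (Fin M)), A.card = N →
      μ {ω | S i t ω = A} = 1 / (Nat.choose M N : ENNReal))
    -- server update with proximal anchor at the task-initial model `θ_i^0 = θ_{i−1}`
    (hserver : ∀ i t ω, t < T →
      θ i (t + 1) ω = (1 / (1 + lam)) •
        ((θ i t ω + γG • ((N : ℝ)⁻¹ •
            ∑ m ∈ S i t ω, (θloc i t m E ω - θloc i t m 0 ω))) + lam • θ i 0 ω))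
    -- Assumption A1: bounded stochastic gradients
    (hA1 : ∀ i t m e ω, ‖g i t m e ω‖ ≤ B) :
    ∀ i ∈ Finset.Icc 1 K, ∀ t ≤ T,
      ∫ ω, ‖θ i t ω - θ i 0 ω‖ ^ 2 ∂μ ≤
        γG ^ 2 * γL ^ 2 * (E : ℝ) ^ 2 * B ^ 2 / lam ^ 2 := by
  intro i _ t ht
  have hloc : ∀ t m ω e, e ≤ E → ‖θloc i t m e ω - θloc i t m 0 ω‖ ≤ (e : ℝ) * (γL * B) := by
    intro t m ω e
    induction e with
    | zero => intro _; simp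
    | succ e ih =>
      intro he
      have h1 := ih (by omega)
      rw [hlocstep i t m e ω (by omega)]
      have h2 : θloc i t m e ω - γL • g i t m e ω - θloc i t m 0 ω
          = (θloc i t m e ω - θloc i t m 0 ω) - γL • g i t m e ω := by abel
      rw [h2]
      have h3 : ‖γL • g i t m e ω‖ ≤ γL * B := by
        rw [norm_smul, Real.norm_of_nonneg hγL.le]
        exact mul_le_mul_of_nonneg_left (hA1 i t m e ω) hγL.le
      have h4 := norm_sub_le (θloc i t m e ω - θloc i t m 0 ω) (γL • g i t m e ω)
      push_cast
      linarith
  have hNpos : (0 : ℝ) < N := by exact_mod_cast hN1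
  have hdelta : ∀ t ω, ‖γG • ((N : ℝ)⁻¹ •
      ∑ m ∈ S i t ω, (θloc i t m E ω - θloc i t m 0 ω))‖ ≤ γG * (E * (γL * B)) := by
    intro t ω
    rw [norm_smul, norm_smul, Real.norm_of_nonneg hγG.le,
      Real.norm_of_nonneg (inv_nonneg.mpr hNpos.le)]
    have h1 : ‖∑ m ∈ S i t ω, (θloc i t m E ω - θloc i t m 0 ω)‖ ≤ (N : ℝ) * (E * (γL * B)) := by
      refine (norm_sum_le_of_le _ (fun m _ => hloc t m ω E le_rfl)).trans ?_
      rw [Finset.sum_const, hcard, nsmul_eq_mul]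
    refine mul_le_mul_of_nonneg_left ?_ hγG.le
    rw [inv_mul_le_iff₀ hNpos]
    exact h1
  have hpt : ∀ t, t ≤ T → ∀ ω, ‖θ i t ω - θ i 0 ω‖ ≤ γG * (E * (γL * B)) / lam := by
    intro t
    induction t with
    | zero => intro _ ω; simp; positivity
    | succ t ih =>
      intro ht ω
      have h1 := ih (by omega) ω
      have h2 := hdelta t ω
      rw [hserver i t ω (by omega)]
      set D := γG • ((N : ℝ)⁻¹ • ∑ m ∈ S i t ω, (θloc i t m E ω - θloc i t m 0 ω))
      have hl : (0 : ℝ) < 1 + lam := by linarith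
      have h3 : (1 / (1 + lam)) • ((θ i t ω + D) + lam • θ i 0 ω) - θ i 0 ω
          = (1 / (1 + lam)) • ((θ i t ω - θ i 0 ω) + D) := by
        have h5 : θ i 0 ω = (1 / (1 + lam)) • ((1 + lam) • θ i 0 ω) := by
          rw [smul_smul, one_div, inv_mul_cancel₀ hl.ne', one_smul]
        nth_rewrite 2 [h5]
        rw [← smul_sub]
        congr 1
        module
      rw [h3, norm_smul, Real.norm_of_nonneg (by positivity), one_div, inv_mul_le_iff₀ hl]
      have h4 := norm_add_le (θ i t ω - θ i 0 ω) D
      have h6 : (1 + lam) * (γG * (E * (γL * B)) / lam)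
          = γG * (E * (γL * B)) / lam + γG * (E * (γL * B)) := by
        field_simp
      linarith
  have hsq : ∀ ω, ‖θ i t ω - θ i 0 ω‖ ^ 2 ≤
      γG ^ 2 * γL ^ 2 * (E : ℝ) ^ 2 * B ^ 2 / lam ^ 2 := by
    intro ω
    refine (pow_le_pow_left₀ (norm_nonneg _) (hpt t ht ω) 2).trans (le_of_eq ?_)
    ring
  calc ∫ ω, ‖θ i t ω - θ i 0 ω‖ ^ 2 ∂μ
      ≤ ∫ _ω, γG ^ 2 * γL ^ 2 * (E : ℝ) ^ 2 * B ^ 2 / lam ^ 2 ∂μ :=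
        integral_mono_of_nonneg (Filter.Eventually.of_forall fun _ => by positivity)
          (integrable_const _) (Filter.Eventually.of_forall hsq)
    _ = _ := by simp
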